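/- arXiv:1711.06855 — 6 statements merged into one kernel-verified Lean document; each statement's English description precedes it below -/
import Mathlib

section
/- Let the binary-valued stochastic process l belong to the class Λ_ρ for some ρ ∈ [0,1]. Suppose A ∈ ℝ^{n×n}, B ∈ ℝ^{n×m}, K ∈ ℝ^{m×n}, and there exist a positive-definite symmetric matrix P ∈ ℝ^{n×n} and scalars β ∈ (0,1), φ ∈ [1,∞) such that (A+BK)ᵀP(A+BK) − βP ⪯ 0, AᵀPA − φP ⪯ 0, and (1−ρ)·ln β + ρ·ln φ < 0. Then for every initial condition x₀ ∈ ℝⁿ, the random trajectory defined by x(0)=x₀ and x(t+1) = (A + (1−l(t))BK) x(t) satisfies ℙ[ lim_{t→∞} ‖x(t)‖ = 0 ] = 1. -/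
open MeasureTheory Filter Set Matrix

/-- A binary-valued process `l` belongs to the class `Λ_ρ` if
`∑_{k=1}^∞ ℙ[∑_{t=0}^{k-1} l(t) > ρ k] < ∞`. -/
def MemLambda {Ω : Type*} [MeasurableSpace Ω] (μ : Measure Ω)
    (l : ℕ → Ω → ℕ) (ρ : ℝ) : Prop :=
  ∑' k : ℕ,
    μ {ω | ρ * ((k : ℝ) + 1) < ∑ t ∈ Finset.range (k + 1), (l t ω : ℝ)} < ⊤


lemma quad_lower {n : ℕ} (P : Matrix (Fin n) (Fin n) ℝ) (hP : P.PosDef) :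
    ∃ c > 0, ∀ v : Fin n → ℝ, c * ‖v‖ ^ 2 ≤ v ⬝ᵥ (P *ᵥ v) := by
  have hpos : ∀ v : Fin n → ℝ, v ≠ 0 → 0 < v ⬝ᵥ (P *ᵥ v) := by
    intro v hv
    simpa using hP.dotProduct_mulVec_pos hv
  have hcont : Continuous (fun v : Fin n → ℝ => v ⬝ᵥ (P *ᵥ v)) := by fun_prop
  by_cases hne : (Metric.sphere (0 : Fin n → ℝ) 1).Nonempty
  · obtain ⟨w, hw, hmin⟩ := (isCompact_sphere (0 : Fin n → ℝ) 1).exists_isMinOn hne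
      hcont.continuousOn
    have hw0 : w ≠ 0 := by
      rintro rfl
      simp at hw
    refine ⟨_, hpos w hw0, fun v => ?_⟩
    by_cases hv : v = 0
    · simp [hv]
    have hn : ‖v‖ ≠ 0 := norm_ne_zero_iff.2 hv
    have hmem : ‖v‖⁻¹ • v ∈ Metric.sphere (0 : Fin n → ℝ) 1 := by
      simp [norm_smul, hn]
    have := hmin hmem
    simp only [mem_setOf_eq, mulVec_smul, dotProduct_smul, smul_dotProduct, smul_eq_mul] at this
    calc _ ≤ (‖v‖⁻¹ * (‖v‖⁻¹ * (v ⬝ᵥ (P *ᵥ v)))) * ‖v‖ ^ 2 := by gcongr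
      _ = _ := by field_simp
  · refine ⟨1, one_pos, fun v => ?_⟩
    by_cases hv : v = 0
    · simp [hv]
    · have hn : ‖v‖ ≠ 0 := norm_ne_zero_iff.2 hv
      exact absurd ⟨‖v‖⁻¹ • v, by simp [norm_smul, hn]⟩ hne

lemma quad_step {n : ℕ} (P M : Matrix (Fin n) (Fin n) ℝ) (b : ℝ)
    (h : (b • P - Mᵀ * P * M).PosSemidef) (v : Fin n → ℝ) :
    (M *ᵥ v) ⬝ᵥ (P *ᵥ (M *ᵥ v)) ≤ b * (v ⬝ᵥ (P *ᵥ v)) := by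
  have h0 := h.dotProduct_mulVec_nonneg v
  simp only [star_trivial, sub_mulVec, dotProduct_sub, smul_mulVec, dotProduct_smul,
    smul_eq_mul] at h0
  have e : v ⬝ᵥ ((Mᵀ * P * M) *ᵥ v) = (M *ᵥ v) ⬝ᵥ (P *ᵥ (M *ᵥ v)) := by
    rw [← mulVec_mulVec, ← mulVec_mulVec, dotProduct_mulVec, vecMul_transpose]
  linarith

/-- Theorem 2.1: almost sure asymptotic stability of the closed-loop networked
control system `x(t+1) = (A + (1 - l(t)) B K) x(t)` under `l ∈ Λ_ρ` and the
Lyapunov-type matrix inequalities. -/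
theorem networked_stability {Ω : Type*} [MeasurableSpace Ω] (μ : Measure Ω)
    [IsProbabilityMeasure μ] {n m : ℕ}
    (A : Matrix (Fin n) (Fin n) ℝ) (B : Matrix (Fin n) (Fin m) ℝ)
    (K : Matrix (Fin m) (Fin n) ℝ)
    (l : ℕ → Ω → ℕ) (hbin : ∀ t ω, l t ω ≤ 1) (hmeas : ∀ t, Measurable (l t))
    {ρ : ℝ} (hρ : ρ ∈ Set.Icc (0 : ℝ) 1) (hl : MemLambda μ l ρ)
    (P : Matrix (Fin n) (Fin n) ℝ) (hP : P.PosDef)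
    {β φ : ℝ} (hβ : β ∈ Set.Ioo (0 : ℝ) 1) (hφ : 1 ≤ φ)
    (h1 : (β • P - (A + B * K)ᵀ * P * (A + B * K)).PosSemidef)
    (h2 : (φ • P - Aᵀ * P * A).PosSemidef)
    (h3 : (1 - ρ) * Real.log β + ρ * Real.log φ < 0)
    (x : ℕ → Ω → Fin n → ℝ) (x₀ : Fin n → ℝ)
    (hx0 : ∀ ω, x 0 ω = x₀)
    (hxrec : ∀ t ω, x (t + 1) ω =
      (A + (1 - (l t ω : ℝ)) • (B * K)).mulVec (x t ω)) :
    μ {ω | Filter.Tendsto (fun t => ‖x t ω‖) Filter.atTop (nhds 0)} = 1 := by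
  obtain ⟨hβ0, hβ1⟩ := hβ
  have hφ0 : 0 < φ := by linarith
  set V : (Fin n → ℝ) → ℝ := fun v => v ⬝ᵥ (P *ᵥ v) with hV
  obtain ⟨c, hc, hlow⟩ := quad_lower P hP
  have hVnn : ∀ v, 0 ≤ V v := fun v => le_trans (by positivity) (hlow v)
  have hb : ∀ t ω, V (x t ω) ≤ Real.exp (t * Real.log β +
      (∑ s ∈ Finset.range t, (l s ω : ℝ)) * (Real.log φ - Real.log β)) * V x₀ := by
    intro t ω
    induction t with
    | zero => simp [hx0]
    | succ t ih =>
      rw [hxrec, Finset.sum_range_succ]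
      have hl01 : l t ω = 0 ∨ l t ω = 1 := by have := hbin t ω; omega
      rcases hl01 with h | h
      · have hs := quad_step P (A + B * K) β h1 (x t ω)
        simp only [h, Nat.cast_zero, sub_zero, one_smul, add_zero]
        refine hs.trans ((mul_le_mul_of_nonneg_left ih hβ0.le).trans (le_of_eq ?_))
        rw [← mul_assoc]
        nth_rw 1 [← Real.exp_log hβ0]
        rw [← Real.exp_add]
        push_cast
        ring_nf
      · have hs := quad_step P A φ h2 (x t ω)
        simp only [h, Nat.cast_one, sub_self, zero_smul, add_zero]
        refine hs.trans ((mul_le_mul_of_nonneg_left ih hφ0.le).trans (le_of_eq ?_))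
        rw [← mul_assoc]
        nth_rw 1 [← Real.exp_log hφ0]
        rw [← Real.exp_add]
        push_cast
        ring_nf
  have hdiff : 0 ≤ Real.log φ - Real.log β :=
    sub_nonneg.2 (Real.log_le_log hβ0 (by linarith))
  have hae := ae_eventually_notMem (μ := μ) (ne_of_lt hl)
  have hlim : ∀ᵐ ω ∂μ, Filter.Tendsto (fun t => ‖x t ω‖) Filter.atTop (nhds 0) := by
    filter_upwards [hae] with ω hω
    set r := (1 - ρ) * Real.log β + ρ * Real.log φ with hr
    have hVlim : Tendsto (fun k : ℕ => V (x (k + 1) ω)) atTop (nhds 0) := by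
      have hg : Tendsto (fun k : ℕ => Real.exp r ^ (k + 1) * V x₀) atTop (nhds 0) := by
        have := ((tendsto_pow_atTop_nhds_zero_of_lt_one (Real.exp_pos r).le
          (by simpa using Real.exp_lt_exp.2 h3)).comp (tendsto_add_atTop_nat 1)).mul_const (V x₀)
        simpa using this
      refine squeeze_zero' (Eventually.of_forall fun k => hVnn _) ?_ hg
      filter_upwards [hω] with k hk
      simp only [mem_setOf_eq, not_lt] at hk
      refine (hb (k + 1) ω).trans (mul_le_mul_of_nonneg_right ?_ (hVnn _))
      rw [← Real.exp_nat_mul]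
      apply Real.exp_le_exp.2
      have := mul_le_mul_of_nonneg_right hk hdiff
      push_cast
      rw [hr]
      nlinarith
    rw [← tendsto_add_atTop_iff_nat 1]
    have hsq : Tendsto (fun k : ℕ => ‖x (k + 1) ω‖ ^ 2) atTop (nhds 0) := by
      refine squeeze_zero (fun k => by positivity) (fun k => ?_)
        (by simpa using hVlim.const_mul c⁻¹)
      rw [inv_mul_eq_div, le_div_iff₀ hc, mul_comm]
      exact hlow _
    simpa using hsq.sqrt
  exact (measure_congr (eventuallyEq_univ.2 hlim)).trans measure_univ
end

section
/- Let (ℱ_t)_{t∈ℕ} be a filtration on a probability space (Ω, ℱ, ℙ) and let l be a binary-valued process adapted to (ℱ_t) such that for some p₁ ∈ (0,1) and every t ∈ ℕ, ℙ[ l(t+1) = 1 ∣ ℱ_t ] ≤ p₁ almost surely. Then for every ρ ∈ (p₁, 1], the process l belongs to the class Λ_ρ, i.e., ∑_{k=1}^∞ ℙ[ ∑_{t=0}^{k-1} l(t) > ρk ] < ∞. -/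
open MeasureTheory Filter Set

/-- Partial sums of a binary process are bounded measurable, so the exponential is integrable. -/
lemma aux_int {Ω : Type*} {m0 : MeasurableSpace Ω} {μ : Measure Ω}
    [IsProbabilityMeasure μ] (f : Ω → ℝ) (hf : Measurable f) (C : ℝ) (h : ∀ ω, |f ω| ≤ C) :
    Integrable f μ :=
  Integrable.of_bound hf.aestronglyMeasurable C (Eventually.of_forall h)

lemma aux_step {Ω : Type*} {m0 : MeasurableSpace Ω} {μ : Measure Ω}
    [IsProbabilityMeasure μ] (ℱ : Filtration ℕ m0)
    (l : ℕ → Ω → ℕ) (hbin : ∀ t ω, l t ω ≤ 1)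
    (hadp : ∀ t, Measurable[ℱ t] (l t))
    {p₁ : ℝ} (hp₁ : p₁ ∈ Set.Ioo (0 : ℝ) 1)
    (hcond : ∀ t, ∀ᵐ ω ∂μ,
      (μ[Set.indicator {ω' | l (t + 1) ω' = 1} (fun _ => (1 : ℝ)) | ℱ t]) ω ≤ p₁)
    (s : ℝ) (hs : 0 < s) (k : ℕ) :
    Integrable (fun ω => Real.exp (s * ∑ t ∈ Finset.range (k + 1), (l t ω : ℝ))) μ ∧
    ∫ ω, Real.exp (s * ∑ t ∈ Finset.range (k + 1), (l t ω : ℝ)) ∂μ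
      ≤ Real.exp s * (1 + (Real.exp s - 1) * p₁) ^ k := by
  have hm : ∀ k, Measurable[ℱ k]
      (fun ω => Real.exp (s * ∑ t ∈ Finset.range (k + 1), (l t ω : ℝ))) := by
    intro k
    apply Real.measurable_exp.comp
    apply Measurable.const_mul
    apply Finset.measurable_sum
    intro t ht
    have := (hadp t).mono (ℱ.mono (Nat.lt_succ_iff.mp (Finset.mem_range.mp ht))) le_rfl
    exact (measurable_from_top (f := fun n : ℕ => (n : ℝ))).comp this
  have hb : ∀ k ω, ∑ t ∈ Finset.range (k + 1), (l t ω : ℝ) ≤ (k : ℝ) + 1 := by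
    intro k ω
    calc _ ≤ ∑ t ∈ Finset.range (k + 1), (1 : ℝ) :=
          Finset.sum_le_sum fun t _ => by exact_mod_cast hbin t ω
      _ = _ := by simp
  have hint : ∀ k, Integrable
      (fun ω => Real.exp (s * ∑ t ∈ Finset.range (k + 1), (l t ω : ℝ))) μ := by
    intro k
    refine aux_int _ ((hm k).mono (ℱ.le k) le_rfl) (Real.exp (s * (k + 1))) fun ω => ?_
    rw [abs_of_pos (Real.exp_pos _)]
    exact Real.exp_le_exp.mpr (mul_le_mul_of_nonneg_left (hb k ω) hs.le)
  refine ⟨hint k, ?_⟩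
  have he : 0 ≤ Real.exp s - 1 := by linarith [Real.add_one_le_exp s]
  induction k with
  | zero =>
    calc _ ≤ ∫ ω, Real.exp s ∂μ := by
          refine integral_mono (hint 0) (integrable_const _) fun ω => ?_
          apply Real.exp_le_exp.mpr
          have := hb 0 ω
          have := mul_le_mul_of_nonneg_left this hs.le
          simpa using this
      _ = _ := by simp
  | succ k ih =>
    set f : Ω → ℝ := fun ω => Real.exp (s * ∑ t ∈ Finset.range (k + 1), (l t ω : ℝ)) with hf
    set g : Ω → ℝ := Set.indicator {ω' | l (k + 1) ω' = 1} (fun _ => (1 : ℝ)) with hg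
    have hgm : Measurable g := by
      refine measurable_const.indicator ?_
      exact ((hadp (k+1)).mono (ℱ.le _) le_rfl) (measurableSet_singleton 1)
    have hgi : Integrable g μ := aux_int _ hgm 1 fun ω => by
      by_cases h : l (k+1) ω = 1 <;> simp [hg, Set.indicator, h]
    have hfgi : Integrable (f * g) μ := by
      refine (hint k).mono (((hm k).mono (ℱ.le k) le_rfl).mul hgm).aestronglyMeasurable ?_
      refine Eventually.of_forall fun ω => ?_
      by_cases h : l (k+1) ω = 1 <;> simp [hf, hg, Set.indicator, h, Real.exp_nonneg]
    have hce : ∫ ω, (f * g) ω ∂μ ≤ p₁ * ∫ ω, f ω ∂μ := by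
      have h1 := condExp_mul_of_stronglyMeasurable_left (μ := μ) (hm k).stronglyMeasurable hfgi hgi
      rw [← integral_condExp (ℱ.le k), integral_congr_ae h1, ← integral_const_mul]
      refine integral_mono_ae (integrable_condExp.congr h1) ((hint k).const_mul _) ?_
      filter_upwards [hcond k] with ω hω
      have := mul_le_mul_of_nonneg_left hω (Real.exp_nonneg
        (s * ∑ t ∈ Finset.range (k + 1), (l t ω : ℝ)))
      simp only [Pi.mul_apply, hf]
      linarith
    have heq : (fun ω => Real.exp (s * ∑ t ∈ Finset.range (k + 1 + 1), (l t ω : ℝ)))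
        = fun ω => f ω + (Real.exp s - 1) * (f * g) ω := by
      funext ω
      rw [Finset.sum_range_succ, mul_add, Real.exp_add]
      have := hbin (k+1) ω
      rcases Nat.le_one_iff_eq_zero_or_eq_one.mp this with h | h
      · simp [hf, hg, Set.indicator, h]
      · simp [hf, hg, Set.indicator, h]; ring
    rw [heq, integral_add (hint k) (hfgi.const_mul _), integral_const_mul]
    have h2 := mul_le_mul_of_nonneg_left hce he
    have h3 : 0 ≤ 1 + (Real.exp s - 1) * p₁ := by
      have := mul_nonneg he hp₁.1.le
      linarith
    have h4 := mul_le_mul_of_nonneg_left ih h3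
    rw [pow_succ]
    linarith

/-- Proposition 2.2 (filtration form): if `l` is an adapted binary process with
`ℙ[l(t+1) = 1 ∣ ℱ_t] ≤ p₁` a.s. for some `p₁ ∈ (0,1)`, then `l ∈ Λ_ρ` for every
`ρ ∈ (p₁, 1]`. -/
theorem gamma_mem_lambda {Ω : Type*} {m0 : MeasurableSpace Ω} {μ : Measure Ω}
    [IsProbabilityMeasure μ] (ℱ : Filtration ℕ m0)
    (l : ℕ → Ω → ℕ) (hbin : ∀ t ω, l t ω ≤ 1)
    (hadp : ∀ t, Measurable[ℱ t] (l t))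
    {p₁ : ℝ} (hp₁ : p₁ ∈ Set.Ioo (0 : ℝ) 1)
    (hcond : ∀ t, ∀ᵐ ω ∂μ,
      (μ[Set.indicator {ω' | l (t + 1) ω' = 1} (fun _ => (1 : ℝ)) | ℱ t]) ω ≤ p₁)
    {ρ : ℝ} (hρ : ρ ∈ Set.Ioc p₁ 1) :
    MemLambda μ l ρ := by
  obtain ⟨hp0, hp1⟩ := hp₁
  obtain ⟨hr0, hr1⟩ := hρ
  obtain ⟨s, hs⟩ : ∃ s, s = (ρ - p₁) / 2 := ⟨_, rfl⟩
  have hs0 : 0 < s := by linarith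
  have hs1 : s ≤ 1 := by linarith
  set q : ℝ := 1 + (Real.exp s - 1) * p₁ with hq
  have hq0 : 0 < q := by
    have : 0 ≤ Real.exp s - 1 := by linarith [Real.add_one_le_exp s]
    have := mul_nonneg this hp0.le
    linarith
  have hqr : q < Real.exp (s * ρ) := by
    have h1 : Real.exp s - 1 ≤ s + s ^ 2 := by
      have := (abs_le.mp (Real.abs_exp_sub_one_sub_id_le (x := s)
        (by rwa [abs_of_pos hs0]))).2
      linarith
    have h2 := mul_le_mul_of_nonneg_right h1 hp0.le
    have h3 := Real.add_one_le_exp (s * ρ)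
    have h4 : s * (p₁ + s * p₁) < s * ρ := by
      apply mul_lt_mul_of_pos_left _ hs0
      nlinarith
    nlinarith
  set a : ℝ := q * Real.exp (-(s * ρ)) with ha
  have ha0 : 0 ≤ a := by positivity
  have ha1 : a < 1 := by
    rw [ha, Real.exp_neg, ← div_eq_mul_inv, div_lt_one (Real.exp_pos _)]
    exact hqr
  have key : ∀ k : ℕ,
      μ {ω | ρ * ((k : ℝ) + 1) < ∑ t ∈ Finset.range (k + 1), (l t ω : ℝ)}
        ≤ ENNReal.ofReal (Real.exp s * Real.exp (-(s * ρ)) * a ^ k) := by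
    intro k
    obtain ⟨hi, hle⟩ := aux_step ℱ l hbin hadp ⟨hp0, hp1⟩ hcond s hs0 k
    have hmk := ProbabilityTheory.measure_ge_le_exp_mul_mgf (μ := μ)
      (X := fun ω => ∑ t ∈ Finset.range (k + 1), (l t ω : ℝ)) (ρ * ((k : ℝ) + 1)) hs0.le hi
    refine (measure_mono (t := {ω | ρ * ((k : ℝ) + 1) ≤ ∑ t ∈ Finset.range (k + 1), (l t ω : ℝ)})
      fun ω hω => by simp only [Set.mem_setOf_eq] at hω ⊢; exact hω.le).trans ?_
    rw [← ofReal_measureReal]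
    apply ENNReal.ofReal_le_ofReal
    refine hmk.trans ?_
    have h5 := mul_le_mul_of_nonneg_left hle (Real.exp_nonneg (-s * (ρ * ((k : ℝ) + 1))))
    refine h5.trans (le_of_eq ?_)
    have h6 : Real.exp (-s * (ρ * ((k : ℝ) + 1)))
        = Real.exp (-(s * ρ)) ^ k * Real.exp (-(s * ρ)) := by
      rw [← Real.exp_nat_mul, ← Real.exp_add]
      congr 1
      ring
    rw [h6, ha, mul_pow]
    ring
  have hsum : Summable fun k : ℕ => Real.exp s * Real.exp (-(s * ρ)) * a ^ k :=
    (summable_geometric_of_lt_one ha0 ha1).mul_left _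
  unfold MemLambda
  refine (ENNReal.tsum_le_tsum key).trans_lt ?_
  exact hsum.tsum_ofReal_lt_top
end

section
/- Let (ℱ_t)_{t∈ℕ} be a filtration on a probability space (Ω, ℱ, ℙ) and let l^{(1)} be a binary-valued process adapted to (ℱ_t) such that for some p₁^{(1)} ∈ [0,1] and every t ∈ ℕ, ℙ[ l^{(1)}(t+1) = 1 ∣ ℱ_t ] ≤ p₁^{(1)} almost surely. Let l^{(2)} be a binary-valued process with l^{(2)} ∈ Λ_{ρ^{(2)}} for some ρ^{(2)} ∈ [0,1], such that the σ-algebra generated by (l^{(2)}(t))_{t∈ℕ} is independent of ℱ_∞ = σ(⋃_t ℱ_t), and assume p₁^{(1)} ρ^{(2)} < 1. Then the process l̃ defined by l̃(t) := l^{(1)}(t) ∧ l^{(2)}(t) satisfies l̃ ∈ Λ_{ρ̃} for every ρ̃ ∈ (p₁^{(1)} ρ^{(2)}, 1]. -/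
open MeasureTheory Filter Set ProbabilityTheory

lemma aux_step_s7 {Ω : Type*} {m m0 : MeasurableSpace Ω} {μ : Measure Ω}
    [IsProbabilityMeasure μ] (hm : m ≤ m0) (X : Ω → ℝ) (hX : Measurable[m] X) (C : ℝ)
    (hX0 : ∀ ω, 0 ≤ X ω) (hXC : ∀ ω, X ω ≤ C) (B : Set Ω) (hB : MeasurableSet B) (p : ℝ)
    (hc : ∀ᵐ ω ∂μ, (μ[Set.indicator B (fun _ => (1 : ℝ)) | m]) ω ≤ p) :
    ∫ ω, X ω * Set.indicator B (fun _ => (1 : ℝ)) ω ∂μ ≤ p * ∫ ω, X ω ∂μ := by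
  have hXsm : StronglyMeasurable[m] X := hX.stronglyMeasurable
  have hXi : Integrable X μ := by
    refine Integrable.of_bound (hXsm.mono hm).aestronglyMeasurable C (ae_of_all _ fun ω => ?_)
    rw [Real.norm_of_nonneg (hX0 ω)]; exact hXC ω
  have hBi : Integrable (Set.indicator B (fun _ => (1 : ℝ))) μ :=
    (integrable_const (1 : ℝ)).indicator hB
  have hXB : Integrable (X * Set.indicator B (fun _ => (1 : ℝ))) μ := by
    refine hBi.bdd_mul (c := C) (hXsm.mono hm).aestronglyMeasurable (ae_of_all _ fun ω => ?_)
    rw [Real.norm_of_nonneg (hX0 ω)]; exact hXC ω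
  have h1 := condExp_mul_of_stronglyMeasurable_left hXsm hXB hBi
  have h2 : ∫ ω, X ω * Set.indicator B (fun _ => (1 : ℝ)) ω ∂μ
      = ∫ ω, (μ[X * Set.indicator B (fun _ => (1 : ℝ)) | m]) ω ∂μ := by
    rw [integral_condExp hm]; rfl
  rw [h2, ← integral_const_mul]
  refine integral_mono_ae integrable_condExp (hXi.const_mul p) ?_
  filter_upwards [h1, hc] with ω h1 hc
  rw [h1, Pi.mul_apply, mul_comm p]
  exact mul_le_mul_of_nonneg_left hc (hX0 ω)

lemma aux_mgf {Ω : Type*} {m0 : MeasurableSpace Ω} {μ : Measure Ω}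
    [IsProbabilityMeasure μ] (ℱ : Filtration ℕ m0)
    (l1 : ℕ → Ω → ℕ) (hbin1 : ∀ t ω, l1 t ω ≤ 1)
    (hadp1 : ∀ t, Measurable[ℱ t] (l1 t))
    {p : ℝ} (hp : 0 ≤ p)
    (hcond : ∀ t, ∀ᵐ ω ∂μ,
      (μ[Set.indicator {ω' | l1 (t + 1) ω' = 1} (fun _ => (1 : ℝ)) | ℱ t]) ω ≤ p)
    (L : ℝ) (hL : 0 ≤ L) (s : Finset ℕ) :
    ∫ ω, Real.exp (L * ∑ t ∈ s, (l1 t ω : ℝ)) ∂μ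
      ≤ Real.exp (L + p * (Real.exp L - 1) * (s.card : ℝ)) := by
  have hc : 0 ≤ p * (Real.exp L - 1) := mul_nonneg hp (by linarith [Real.add_one_le_exp L])
  induction s using Finset.induction_on_max with
  | empty => simp [hL]
  | insert a s hs ih =>
    have ha : a ∉ s := fun h => lt_irrefl _ (hs a h)
    rw [Finset.card_insert_of_notMem ha]
    rcases a with _ | t
    · have hs0 : s = ∅ := by
        apply Finset.eq_empty_of_forall_notMem
        intro x hx
        exact absurd (hs x hx) (Nat.not_lt_zero _)
      subst hs0
      calc ∫ ω, Real.exp (L * ∑ t ∈ insert 0 (∅ : Finset ℕ), (l1 t ω : ℝ)) ∂μ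
          ≤ ∫ ω, Real.exp L ∂μ := by
            refine integral_mono_of_nonneg (ae_of_all _ fun ω => (Real.exp_pos _).le)
              (integrable_const _) (ae_of_all _ fun ω => ?_)
            have : (l1 0 ω : ℝ) ≤ 1 := by exact_mod_cast hbin1 0 ω
            simp only [insert_empty_eq, Finset.sum_singleton]
            apply Real.exp_le_exp.2
            nlinarith
        _ = Real.exp L := by simp
        _ ≤ _ := by
            apply Real.exp_le_exp.2
            simp only [Finset.card_empty]; push_cast; linarith
    · set X : Ω → ℝ := fun ω => Real.exp (L * ∑ t ∈ s, (l1 t ω : ℝ)) with hXdef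
      have hXm : Measurable[ℱ t] X := by
        refine Real.measurable_exp.comp (Measurable.const_mul ?_ L)
        refine Finset.measurable_sum _ fun i hi => ?_
        have : Measurable[ℱ t] (l1 i) :=
          (hadp1 i).mono (ℱ.mono (Nat.lt_succ_iff.1 (hs i hi))) le_rfl
        exact (measurable_from_top (f := fun n : ℕ => (n : ℝ))).comp this
      have hX0 : ∀ ω, 0 ≤ X ω := fun ω => (Real.exp_pos _).le
      have hXC : ∀ ω, X ω ≤ Real.exp (L * s.card) := by
        intro ω
        apply Real.exp_le_exp.2
        apply mul_le_mul_of_nonneg_left _ hL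
        calc ∑ t ∈ s, (l1 t ω : ℝ) ≤ ∑ t ∈ s, (1 : ℝ) :=
              Finset.sum_le_sum fun i _ => by exact_mod_cast hbin1 i ω
          _ = _ := by simp
      have hB : MeasurableSet {ω' | l1 (t + 1) ω' = 1} :=
        ((hadp1 (t+1)).mono (ℱ.le _) le_rfl) (measurableSet_singleton 1)
      have hstep := aux_step_s7 (ℱ.le t) X hXm _ hX0 hXC _ hB p (hcond t)
      have hXsm : AEStronglyMeasurable X μ := (hXm.mono (ℱ.le _) le_rfl).aestronglyMeasurable
      have hXi : Integrable X μ := by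
        refine Integrable.of_bound hXsm (Real.exp (L * s.card)) (ae_of_all _ fun ω => ?_)
        rw [Real.norm_of_nonneg (hX0 ω)]; exact hXC ω
      have hXB : Integrable (fun ω => X ω *
          Set.indicator {ω' | l1 (t + 1) ω' = 1} (fun _ => (1 : ℝ)) ω) μ := by
        refine ((integrable_const (1 : ℝ)).indicator hB).bdd_mul (c := Real.exp (L * s.card))
          hXsm (ae_of_all _ fun ω => ?_)
        rw [Real.norm_of_nonneg (hX0 ω)]; exact hXC ω
      have heq : ∀ ω, Real.exp (L * ∑ t ∈ insert (t+1) s, (l1 t ω : ℝ))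
          = X ω + (Real.exp L - 1) *
            (X ω * Set.indicator {ω' | l1 (t + 1) ω' = 1} (fun _ => (1 : ℝ)) ω) := by
        intro ω
        rw [Finset.sum_insert ha, mul_add, Real.exp_add]
        have h01 : l1 (t+1) ω = 0 ∨ l1 (t+1) ω = 1 := by have := hbin1 (t+1) ω; omega
        rcases h01 with h | h
        · simp [h, X]
        · simp [h, X]; ring
      simp_rw [heq]
      rw [integral_add hXi (hXB.const_mul _), integral_const_mul]
      have hexp : 0 ≤ Real.exp L - 1 := by linarith [Real.add_one_le_exp L]
      have h1 := mul_le_mul_of_nonneg_left hstep hexp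
      have hXint : 0 ≤ ∫ ω, X ω ∂μ := integral_nonneg hX0
      calc _ ≤ (1 + p * (Real.exp L - 1)) * ∫ ω, X ω ∂μ := by linarith
        _ ≤ Real.exp (p * (Real.exp L - 1)) *
            Real.exp (L + p * (Real.exp L - 1) * (s.card : ℝ)) := by
            apply mul_le_mul _ ih hXint (Real.exp_pos _).le
            linarith [Real.add_one_le_exp (p * (Real.exp L - 1))]
        _ = _ := by
            rw [← Real.exp_add]; push_cast; ring_nf

lemma aux_tail {Ω : Type*} {m0 : MeasurableSpace Ω} {μ : Measure Ω}
    [IsProbabilityMeasure μ] (ℱ : Filtration ℕ m0)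
    (l1 : ℕ → Ω → ℕ) (hbin1 : ∀ t ω, l1 t ω ≤ 1)
    (hadp1 : ∀ t, Measurable[ℱ t] (l1 t))
    {p : ℝ} (hp : 0 ≤ p)
    (hcond : ∀ t, ∀ᵐ ω ∂μ,
      (μ[Set.indicator {ω' | l1 (t + 1) ω' = 1} (fun _ => (1 : ℝ)) | ℱ t]) ω ≤ p)
    (L : ℝ) (hL : 0 ≤ L) (s : Finset ℕ) (x : ℝ) :
    μ {ω | x < ∑ t ∈ s, (l1 t ω : ℝ)}
      ≤ ENNReal.ofReal (Real.exp (L + p * (Real.exp L - 1) * (s.card : ℝ) - L * x)) := by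
  have hm : Measurable (fun ω => ∑ t ∈ s, (l1 t ω : ℝ)) := by
    refine Finset.measurable_sum _ fun i hi => ?_
    exact (measurable_from_top (f := fun n : ℕ => (n : ℝ))).comp
      ((hadp1 i).mono (ℱ.le _) le_rfl)
  have hi : Integrable (fun ω => Real.exp (L * ∑ t ∈ s, (l1 t ω : ℝ))) μ := by
    refine Integrable.of_bound (Real.measurable_exp.comp (hm.const_mul L)).aestronglyMeasurable
      (Real.exp (L * s.card)) (ae_of_all _ fun ω => ?_)
    rw [Real.norm_of_nonneg (Real.exp_pos _).le]
    apply Real.exp_le_exp.2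
    apply mul_le_mul_of_nonneg_left _ hL
    calc ∑ t ∈ s, (l1 t ω : ℝ) ≤ ∑ t ∈ s, (1 : ℝ) :=
          Finset.sum_le_sum fun i _ => by exact_mod_cast hbin1 i ω
      _ = _ := by simp
  have h := measure_ge_le_exp_mul_mgf (μ := μ) (X := fun ω => ∑ t ∈ s, (l1 t ω : ℝ)) x hL hi
  have h2 := aux_mgf ℱ l1 hbin1 hadp1 hp hcond L hL s
  calc μ {ω | x < ∑ t ∈ s, (l1 t ω : ℝ)} ≤ μ {ω | x ≤ ∑ t ∈ s, (l1 t ω : ℝ)} :=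
        measure_mono fun ω (hω : x < _) => show x ≤ _ from le_of_lt hω
    _ = ENNReal.ofReal (μ.real {ω | x ≤ ∑ t ∈ s, (l1 t ω : ℝ)}) := by
        rw [ofReal_measureReal]
    _ ≤ _ := by
        apply ENNReal.ofReal_le_ofReal
        refine h.trans ?_
        rw [sub_eq_add_neg, Real.exp_add, mul_comm, ← neg_mul]
        exact mul_le_mul_of_nonneg_right h2 (Real.exp_pos _).le

/-- Theorem 3.3 (filtration form): if `l⁽¹⁾` satisfies the `Γ`-type conditional
bound `ℙ[l⁽¹⁾(t+1)=1 ∣ ℱ_t] ≤ p₁⁽¹⁾` a.s., `l⁽²⁾ ∈ Λ_{ρ⁽²⁾}` is independent of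
`ℱ_∞`, and `p₁⁽¹⁾ ρ⁽²⁾ < 1`, then `l̃(t) = l⁽¹⁾(t) ∧ l⁽²⁾(t)` satisfies
`l̃ ∈ Λ_ρ̃` for every `ρ̃ ∈ (p₁⁽¹⁾ ρ⁽²⁾, 1]`. -/
theorem and_gamma_lambda {Ω : Type*} {m0 : MeasurableSpace Ω} {μ : Measure Ω}
    [IsProbabilityMeasure μ] (ℱ : Filtration ℕ m0)
    (l1 : ℕ → Ω → ℕ) (hbin1 : ∀ t ω, l1 t ω ≤ 1)
    (hadp1 : ∀ t, Measurable[ℱ t] (l1 t))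
    {p11 : ℝ} (hp11 : p11 ∈ Set.Icc (0 : ℝ) 1)
    (hcond : ∀ t, ∀ᵐ ω ∂μ,
      (μ[Set.indicator {ω' | l1 (t + 1) ω' = 1} (fun _ => (1 : ℝ)) | ℱ t]) ω ≤ p11)
    (l2 : ℕ → Ω → ℕ) (hbin2 : ∀ t ω, l2 t ω ≤ 1) (hmeas2 : ∀ t, Measurable (l2 t))
    {ρ2 : ℝ} (hρ2 : ρ2 ∈ Set.Icc (0 : ℝ) 1) (hl2 : MemLambda μ l2 ρ2)
    (hindep : Indep (⨆ t, MeasurableSpace.comap (l2 t) inferInstance)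
      (⨆ t, (ℱ t : MeasurableSpace Ω)) μ)
    (hlt : p11 * ρ2 < 1)
    {ρ : ℝ} (hρ : ρ ∈ Set.Ioc (p11 * ρ2) 1) :
    MemLambda μ (fun t ω => min (l1 t ω) (l2 t ω)) ρ := by
  obtain ⟨hp0, hp1⟩ := hp11
  obtain ⟨hr0, hr1⟩ := hρ2
  obtain ⟨hq, hρ1⟩ := hρ
  have hq0 : 0 ≤ p11 * ρ2 := mul_nonneg hp0 hr0
  set L : ℝ := (ρ - p11 * ρ2) / 2 with hLdef
  have hL : 0 < L := by rw [hLdef]; linarith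
  have hL1 : L ≤ 1 := by rw [hLdef]; linarith
  set c : ℝ := p11 * (Real.exp L - 1) with hcdef
  have hexp : 0 ≤ Real.exp L - 1 := by linarith [Real.add_one_le_exp L]
  have hc0 : 0 ≤ c := mul_nonneg hp0 hexp
  have hδ : 0 < L * ρ - c * ρ2 := by
    have h1 : Real.exp L - 1 ≤ L + L ^ 2 := by
      have := Real.abs_exp_sub_one_sub_id_le (x := L) (by rw [abs_of_pos hL]; exact hL1)
      have := (abs_le.1 this).2
      linarith
    have h2 : c * ρ2 ≤ p11 * ρ2 * (L + L ^ 2) := by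
      rw [hcdef, mul_right_comm]
      exact mul_le_mul_of_nonneg_left h1 hq0
    have h3 : p11 * ρ2 * (L * L) ≤ 1 * (L * L) :=
      mul_le_mul_of_nonneg_right hlt.le (by positivity)
    have h4 : ρ = p11 * ρ2 + 2 * L := by rw [hLdef]; ring
    have h5 : 0 < L * L := by positivity
    rw [h4]
    nlinarith
  set δ := L * ρ - c * ρ2 with hδdef
  -- pointwise bound
  have key : ∀ k : ℕ,
      μ {ω | ρ * ((k : ℝ) + 1) < ∑ t ∈ Finset.range (k + 1), ((min (l1 t ω) (l2 t ω) : ℕ) : ℝ)}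
      ≤ μ {ω | ρ2 * ((k : ℝ) + 1) < ∑ t ∈ Finset.range (k + 1), (l2 t ω : ℝ)}
        + ENNReal.ofReal (Real.exp L * Real.exp (-δ) ^ (k + 1)) := by
    intro k
    set B : ENNReal := ENNReal.ofReal (Real.exp L * Real.exp (-δ) ^ (k + 1)) with hB
    let A : Finset ℕ → Set Ω := fun s =>
      ⋂ t ∈ Finset.range (k + 1), {ω | l2 t ω = 1 ↔ t ∈ s}
    have hAm : ∀ s, MeasurableSet[⨆ t, MeasurableSpace.comap (l2 t) inferInstance] (A s) := by
      intro s
      refine Finset.measurableSet_biInter _ fun t _ => ?_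
      exact (le_iSup (fun t => MeasurableSpace.comap (l2 t) inferInstance) t) _
        ⟨{n | n = 1 ↔ t ∈ s}, trivial, rfl⟩
    have hle2 : (⨆ t, MeasurableSpace.comap (l2 t) inferInstance) ≤ m0 :=
      iSup_le fun t => (hmeas2 t).comap_le
    let T : Finset (Finset ℕ) :=
      (Finset.range (k + 1)).powerset.filter fun s => (s.card : ℝ) ≤ ρ2 * ((k : ℝ) + 1)
    let D : Finset ℕ → Set Ω := fun s => {ω | ρ * ((k : ℝ) + 1) < ∑ t ∈ s, (l1 t ω : ℝ)}
    have hDm : ∀ s, MeasurableSet[⨆ t, (ℱ t : MeasurableSpace Ω)] (D s) := by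
      intro s
      refine measurableSet_lt measurable_const (Finset.measurable_sum _ fun i _ => ?_)
      exact (measurable_from_top (f := fun n : ℕ => (n : ℝ))).comp
        ((hadp1 i).mono (le_iSup (fun t => (ℱ t : MeasurableSpace Ω)) i) le_rfl)
    have hDB : ∀ s ∈ T, μ (D s) ≤ B := by
      intro s hs
      refine (aux_tail ℱ l1 hbin1 hadp1 hp0 hcond L hL.le s _).trans ?_
      apply ENNReal.ofReal_le_ofReal
      rw [← Real.exp_nat_mul, ← Real.exp_add]
      apply Real.exp_le_exp.2
      have h1 : (s.card : ℝ) ≤ ρ2 * ((k : ℝ) + 1) := (Finset.mem_filter.1 hs).2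
      have h2 := mul_le_mul_of_nonneg_left h1 hc0
      push_cast
      rw [hδdef]
      linarith
    have hsub : {ω | ρ * ((k : ℝ) + 1)
          < ∑ t ∈ Finset.range (k + 1), ((min (l1 t ω) (l2 t ω) : ℕ) : ℝ)}
        ⊆ {ω | ρ2 * ((k : ℝ) + 1) < ∑ t ∈ Finset.range (k + 1), (l2 t ω : ℝ)}
          ∪ ⋃ s ∈ T, A s ∩ D s := by
      intro ω hω
      by_cases hb : ρ2 * ((k : ℝ) + 1) < ∑ t ∈ Finset.range (k + 1), (l2 t ω : ℝ)
      · exact Or.inl hb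
      right
      have e2 : ∀ t, (l2 t ω : ℝ) = if l2 t ω = 1 then 1 else 0 := by
        intro t
        have h01 : l2 t ω = 0 ∨ l2 t ω = 1 := by have := hbin2 t ω; omega
        rcases h01 with h | h <;> simp [h]
      have e1 : ∀ t, ((min (l1 t ω) (l2 t ω) : ℕ) : ℝ)
          = if l2 t ω = 1 then (l1 t ω : ℝ) else 0 := by
        intro t
        have h01 : l2 t ω = 0 ∨ l2 t ω = 1 := by have := hbin2 t ω; omega
        rcases h01 with h | h
        · simp [h]
        · simp only [h, min_eq_left (hbin1 t ω), if_true]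
      rw [not_lt] at hb
      refine Set.mem_iUnion₂.2 ⟨(Finset.range (k + 1)).filter fun t => l2 t ω = 1, ?_, ?_, ?_⟩
      · refine Finset.mem_filter.2 ⟨Finset.mem_powerset.2 (Finset.filter_subset _ _), ?_⟩
        rw [Finset.sum_congr rfl fun t _ => e2 t, ← Finset.sum_filter] at hb
        simpa using hb
      · refine Set.mem_iInter₂.2 fun t ht => ?_
        simp only [Set.mem_ofPred_eq, Finset.mem_filter, ht, true_and]
      · have hω' : ρ * ((k : ℝ) + 1)
          < ∑ t ∈ Finset.range (k + 1), ((min (l1 t ω) (l2 t ω) : ℕ) : ℝ) := hω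
        rw [Finset.sum_congr rfl fun t _ => e1 t, ← Finset.sum_filter] at hω'
        exact hω'
    have hdisj : (T : Set (Finset ℕ)).PairwiseDisjoint A := by
      intro s hs s' hs' hne
      refine Set.disjoint_left.2 fun ω h h' => hne ?_
      have hs1 := Finset.mem_powerset.1 (Finset.mem_filter.1 hs).1
      have hs2 := Finset.mem_powerset.1 (Finset.mem_filter.1 hs').1
      have h1 := Set.mem_iInter₂.1 h
      have h2 := Set.mem_iInter₂.1 h'
      ext t
      constructor
      · intro ht; exact (h2 t (hs1 ht)).1 ((h1 t (hs1 ht)).2 ht)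
      · intro ht; exact (h1 t (hs2 ht)).1 ((h2 t (hs2 ht)).2 ht)
    refine (measure_mono hsub).trans ((measure_union_le _ _).trans ?_)
    gcongr
    calc μ (⋃ s ∈ T, A s ∩ D s) ≤ ∑ s ∈ T, μ (A s ∩ D s) := measure_biUnion_finset_le _ _
      _ = ∑ s ∈ T, μ (A s) * μ (D s) :=
          Finset.sum_congr rfl fun s _ => (Indep_iff _ _ _).1 hindep _ _ (hAm s) (hDm s)
      _ ≤ ∑ s ∈ T, μ (A s) * B :=
          Finset.sum_le_sum fun s hs => mul_le_mul_right (hDB s hs) _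
      _ = μ (⋃ s ∈ T, A s) * B := by
          rw [← Finset.sum_mul, measure_biUnion_finset hdisj fun s _ => hle2 _ (hAm s)]
      _ ≤ 1 * B := mul_le_mul_left prob_le_one _
      _ = B := one_mul _
  unfold MemLambda at hl2 ⊢
  refine (ENNReal.tsum_le_tsum key).trans_lt ?_
  rw [ENNReal.tsum_add]
  refine ENNReal.add_lt_top.2 ⟨hl2, ?_⟩
  have hsum : Summable fun k : ℕ => Real.exp L * Real.exp (-δ) ^ (k + 1) := by
    refine Summable.mul_left _ ?_
    exact (summable_nat_add_iff 1).2 (summable_geometric_of_lt_one (Real.exp_pos _).le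
      (Real.exp_lt_one_iff.2 (by linarith)))
  rw [← ENNReal.ofReal_tsum_of_nonneg (fun k => by positivity) hsum]
  exact ENNReal.ofReal_lt_top
end

section
/- Let 𝒫 be a path with links indexed j ∈ {1,…,m}, and let l^{(1)}, …, l^{(m)} be binary-valued processes (not assumed mutually independent) such that l^{(j)} ∈ Λ_{ρ_j} with ρ_j ∈ [0,1] for each j, and ∑_{j=1}^{m} ρ_j ≤ 1. Define l(t) := l^{(1)}(t) ∨ l^{(2)}(t) ∨ ⋯ ∨ l^{(m)}(t) for t ∈ ℕ. Then l ∈ Λ_ρ with ρ := ∑_{j=1}^{m} ρ_j. -/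
open MeasureTheory Filter Set

/-- Proposition 4.1: if the link failure indicators of a path satisfy
`l^{(j)} ∈ Λ_{ρ_j}` (not assumed independent) and `∑_j ρ_j ≤ 1`, then the path
failure indicator `l(t) = l^{(1)}(t) ∨ ⋯ ∨ l^{(m)}(t)` satisfies `l ∈ Λ_ρ` with
`ρ = ∑_j ρ_j`.  Here the number of links is `m + 1 ≥ 1`. -/
theorem path_or_sum {Ω : Type*} [MeasurableSpace Ω] (μ : Measure Ω)
    [IsProbabilityMeasure μ] {m : ℕ}
    (l : Fin (m + 1) → ℕ → Ω → ℕ)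
    (hbin : ∀ j t ω, l j t ω ≤ 1) (hmeas : ∀ j t, Measurable (l j t))
    (ρ : Fin (m + 1) → ℝ) (hρ : ∀ j, ρ j ∈ Set.Icc (0 : ℝ) 1)
    (hl : ∀ j, MemLambda μ (l j) (ρ j))
    (hsum : ∑ j, ρ j ≤ 1) :
    MemLambda μ
      (fun t ω => if ∃ j, l j t ω = 1 then 1 else 0)
      (∑ j, ρ j) := by
  unfold MemLambda at *
  refine lt_of_le_of_lt (b := ∑' k : ℕ, ∑ j, μ {ω | ρ j * ((k : ℝ) + 1) <
      ∑ t ∈ Finset.range (k + 1), (l j t ω : ℝ)}) ?_ ?_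
  · refine ENNReal.tsum_le_tsum fun k => ?_
    refine le_trans (measure_mono ?_) (measure_iUnion_fintype_le μ _)
    intro ω hω
    simp only [Set.mem_setOf_eq, Set.mem_iUnion] at hω ⊢
    by_contra! hcon
    refine absurd hω (not_lt.mpr ?_)
    calc ∑ t ∈ Finset.range (k + 1), (((if ∃ j, l j t ω = 1 then 1 else 0 : ℕ)) : ℝ)
        ≤ ∑ t ∈ Finset.range (k + 1), ∑ j, (l j t ω : ℝ) := by
          refine Finset.sum_le_sum fun t _ => ?_
          split_ifs with h
          · obtain ⟨j, hj⟩ := h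
            have := Finset.single_le_sum (f := fun j => (l j t ω : ℝ))
              (fun i _ => Nat.cast_nonneg _) (Finset.mem_univ j)
            simpa [hj] using this
          · rw [Nat.cast_zero]
            exact Finset.sum_nonneg fun i _ => Nat.cast_nonneg _
      _ = ∑ j, ∑ t ∈ Finset.range (k + 1), (l j t ω : ℝ) := Finset.sum_comm
      _ ≤ ∑ j, ρ j * ((k : ℝ) + 1) := Finset.sum_le_sum fun j _ => hcon j
      _ = (∑ j, ρ j) * ((k : ℝ) + 1) := by rw [Finset.sum_mul]
  · rw [Summable.tsum_finsetSum (fun _ _ => ENNReal.summable)]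
    exact ENNReal.sum_lt_top.mpr fun j _ => hl j
end

section
/- Let l_f and l_R be binary-valued processes with l_f ∈ Λ_{ρ_f} and l_R ∈ Λ_{ρ_R}, where ρ_f, ρ_R ∈ [0,1] satisfy ρ_f + ρ_R ≤ 1. Define k̂(t) := ∑_{i=0}^{t-1} (1 − l_f(i)) for t ≥ 1, and define the binary-valued process l̂_R by l̂_R(t) := 0 if l_f(t) = 1, and l̂_R(t) := l_R( k̂(t+1) − 1 ) if l_f(t) = 0. Then the process l_𝒫 defined by l_𝒫(t) := l_f(t) ∨ l̂_R(t) satisfies l_𝒫 ∈ Λ_{ρ_f + ρ_R}. -/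
open MeasureTheory Filter Set

/-- `k̂(t) = ∑_{i=0}^{t-1} (1 − l_f(i))`: the number of packets successfully
forwarded by the packet-dropping first link among the first `t` packets. -/
def khat {Ω : Type*} (lf : ℕ → Ω → ℕ) (t : ℕ) (ω : Ω) : ℕ :=
  ∑ i ∈ Finset.range t, (1 - lf i ω)

/-- The re-indexed subpath failure indicator: `l̂_R(t) = 0` if the first link
drops packet `t`, and `l̂_R(t) = l_R(k̂(t+1) − 1)` otherwise. -/
def lhatR {Ω : Type*} (lf lR : ℕ → Ω → ℕ) (t : ℕ) (ω : Ω) : ℕ :=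
  if lf t ω = 1 then 0 else lR (khat lf (t + 1) ω - 1) ω

lemma sum_lhatR {Ω : Type*} (lf lR : ℕ → Ω → ℕ) (hbinf : ∀ t ω, lf t ω ≤ 1) (ω : Ω) (k : ℕ) :
    ∑ t ∈ Finset.range k, lhatR lf lR t ω = ∑ i ∈ Finset.range (khat lf k ω), lR i ω := by
  induction k with
  | zero => simp [khat]
  | succ k ih =>
    have hk : khat lf (k + 1) ω = khat lf k ω + (1 - lf k ω) := by
      simp [khat, Finset.sum_range_succ]
    rw [Finset.sum_range_succ, ih, lhatR, hk]
    have h := hbinf k ω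
    by_cases h1 : lf k ω = 1
    · simp [h1]
    · have h0 : lf k ω = 0 := by omega
      simp [h0, Finset.sum_range_succ]

lemma khat_le {Ω : Type*} (lf : ℕ → Ω → ℕ) (ω : Ω) (k : ℕ) : khat lf k ω ≤ k := by
  have : khat lf k ω ≤ ∑ i ∈ Finset.range k, 1 :=
    Finset.sum_le_sum (fun i _ => Nat.sub_le _ _)
  simpa using this

lemma sum_path_le {Ω : Type*} (lf lR : ℕ → Ω → ℕ) (hbinf : ∀ t ω, lf t ω ≤ 1) (ω : Ω) (k : ℕ) :
    ∑ t ∈ Finset.range k, max (lf t ω) (lhatR lf lR t ω) ≤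
      ∑ t ∈ Finset.range k, lf t ω + ∑ t ∈ Finset.range k, lR t ω := by
  calc _ ≤ ∑ t ∈ Finset.range k, (lf t ω + lhatR lf lR t ω) :=
        Finset.sum_le_sum (fun i _ => by omega)
    _ = ∑ t ∈ Finset.range k, lf t ω + ∑ i ∈ Finset.range (khat lf k ω), lR i ω := by
        rw [Finset.sum_add_distrib, sum_lhatR lf lR hbinf]
    _ ≤ _ := by
        gcongr
        exact khat_le lf ω k

/-- Lemma 4.4: if `l_f ∈ Λ_{ρ_f}` (the packet-dropping first link of a path)
and `l_R ∈ Λ_{ρ_R}` (the remaining subpath), with `ρ_f + ρ_R ≤ 1`, then the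
end-to-end path failure indicator `l_𝒫(t) = l_f(t) ∨ l̂_R(t)` satisfies
`l_𝒫 ∈ Λ_{ρ_f + ρ_R}`. -/
theorem path_recursive {Ω : Type*} [MeasurableSpace Ω] (μ : Measure Ω)
    [IsProbabilityMeasure μ]
    (lf lR : ℕ → Ω → ℕ)
    (hbinf : ∀ t ω, lf t ω ≤ 1) (hbinR : ∀ t ω, lR t ω ≤ 1)
    (hmf : ∀ t, Measurable (lf t)) (hmR : ∀ t, Measurable (lR t))
    {ρf ρR : ℝ} (hρf : ρf ∈ Set.Icc (0 : ℝ) 1) (hρR : ρR ∈ Set.Icc (0 : ℝ) 1)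
    (hsum : ρf + ρR ≤ 1)
    (hlf : MemLambda μ lf ρf) (hlR : MemLambda μ lR ρR) :
    MemLambda μ (fun t ω => max (lf t ω) (lhatR lf lR t ω)) (ρf + ρR) := by
  unfold MemLambda at *
  refine lt_of_le_of_lt ?_ (ENNReal.add_lt_top.2 ⟨hlf, hlR⟩)
  rw [← ENNReal.tsum_add]
  refine ENNReal.tsum_le_tsum (fun k => ?_)
  refine le_trans (measure_mono ?_) (measure_union_le _ _)
  intro ω hω
  have h : ((∑ t ∈ Finset.range (k + 1), max (lf t ω) (lhatR lf lR t ω) : ℕ) : ℝ) ≤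
      ((∑ t ∈ Finset.range (k + 1), lf t ω + ∑ t ∈ Finset.range (k + 1), lR t ω : ℕ) : ℝ) :=
    Nat.cast_le.2 (sum_path_le lf lR hbinf ω (k + 1))
  by_contra hc
  simp only [Set.mem_union, Set.mem_setOf_eq, not_or, not_lt] at hc hω
  rw [Nat.cast_add, Nat.cast_sum, Nat.cast_sum, Nat.cast_sum] at h
  linarith [hc.1, hc.2, add_mul ρf ρR ((k : ℝ) + 1)]
end

section
/- Let m ≥ 1, let l^{(1)}, …, l^{(m)} be binary-valued processes, and let d_1, …, d_{m} ∈ {corrupting, dropping} be flags for the links of a path, ordered from first to last link. Define processes L^{(m)}, L^{(m−1)}, …, L^{(1)} recursively by L^{(m)} := l^{(m)}, and for j = m−1 down to 1: if d_j = corrupting then L^{(j)}(t) := l^{(j)}(t) ∨ L^{(j+1)}(t); if d_j = dropping then L^{(j)}(t) := 1 if l^{(j)}(t) = 1 and L^{(j)}(t) := L^{(j+1)}( k̂_j(t+1) − 1 ) if l^{(j)}(t) = 0, where k̂_j(t) := ∑_{i=0}^{t-1} (1 − l^{(j)}(i)). Suppose l^{(j)} ∈ Λ_{ρ_j} with ρ_j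 ∈ [0,1] for each j and ∑_{j=1}^{m} ρ_j ≤ 1. Then the path failure process L^{(1)} satisfies L^{(1)} ∈ Λ_ρ with ρ := ∑_{j=1}^{m} ρ_j. -/
open MeasureTheory Filter Set

/-- A link of a path is either data-corrupting or packet-dropping. -/
inductive LinkType
  | corrupting
  | dropping

/-- Combination of a link failure indicator `l` (with link type `d`) with the
failure indicator `L` of the remaining subpath: for a corrupting link failures
combine by `∨` with the same packet index; for a dropping link the subpath
index is re-indexed via `k̂(t+1) − 1 = (∑_{i=0}^{t} (1 − l(i))) − 1`. -/
def combineLink {Ω : Type*} (l : ℕ → Ω → ℕ) (d : LinkType) (L : ℕ → Ω → ℕ) :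
    ℕ → Ω → ℕ :=
  fun t ω =>
    match d with
    | LinkType.corrupting => max (l t ω) (L t ω)
    | LinkType.dropping =>
        if l t ω = 1 then 1
        else L ((∑ i ∈ Finset.range (t + 1), (1 - l i ω)) - 1) ω

/-- `pathFrom l d rem j` is the failure process `L^{(j)}` of the subpath that
starts at link `j` and contains `rem + 1` links (links `j, j+1, …, j+rem`),
defined recursively from the last link backwards. -/
def pathFrom {Ω : Type*} (l : ℕ → ℕ → Ω → ℕ) (d : ℕ → LinkType) :
    ℕ → ℕ → (ℕ → Ω → ℕ)
  | 0, j => l j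
  | rem + 1, j => combineLink (l j) (d j) (pathFrom l d rem (j + 1))

theorem combineLink_sum_le {Ω : Type*} (l : ℕ → Ω → ℕ) (d : LinkType) (L : ℕ → Ω → ℕ)
    (hbin : ∀ t ω, l t ω ≤ 1) (k : ℕ) (ω : Ω) :
    ∑ t ∈ Finset.range k, combineLink l d L t ω ≤
      ∑ t ∈ Finset.range k, l t ω + ∑ t ∈ Finset.range k, L t ω := by
  cases d with
  | corrupting =>
    rw [← Finset.sum_add_distrib]
    refine Finset.sum_le_sum fun t _ => ?_
    simp only [combineLink]
    omega
  | dropping =>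
    have key : ∀ k, ∑ t ∈ Finset.range k, combineLink l LinkType.dropping L t ω =
        ∑ t ∈ Finset.range k, l t ω +
          ∑ s ∈ Finset.range (∑ i ∈ Finset.range k, (1 - l i ω)), L s ω := by
      intro k
      induction k with
      | zero => simp
      | succ k ih =>
        rw [Finset.sum_range_succ, ih]
        simp only [combineLink]
        rw [Finset.sum_range_succ (fun t => l t ω), Finset.sum_range_succ (fun t => 1 - l t ω)]
        have h01 : l k ω = 1 ∨ l k ω = 0 := by have := hbin k ω; omega
        rcases h01 with h | h
        · simp [h]; omega
        · simp [h, Finset.sum_range_succ (fun t => L t ω)]; omega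
    rw [key]
    refine Nat.add_le_add_left ?_ _
    refine Finset.sum_le_sum_of_subset (Finset.range_subset_range.2 ?_)
    calc ∑ i ∈ Finset.range k, (1 - l i ω) ≤ ∑ i ∈ Finset.range k, 1 :=
          Finset.sum_le_sum fun i _ => Nat.sub_le _ _
      _ = k := by simp

theorem pathFrom_sum_le {Ω : Type*} (l : ℕ → ℕ → Ω → ℕ) (d : ℕ → LinkType)
    (hbin : ∀ j t ω, l j t ω ≤ 1) (k : ℕ) (ω : Ω) (n : ℕ) : ∀ j,
    ∑ t ∈ Finset.range k, pathFrom l d n j t ω ≤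
      ∑ i ∈ Finset.range (n + 1), ∑ t ∈ Finset.range k, l (j + i) t ω := by
  induction n with
  | zero => intro j; simp [pathFrom]
  | succ n ih =>
    intro j
    refine (combineLink_sum_le (l j) (d j) _ (hbin j) k ω).trans ?_
    rw [Finset.sum_range_succ' _ (n + 1), add_comm]
    refine Nat.add_le_add ((ih (j + 1)).trans (le_of_eq ?_)) (by simp)
    refine Finset.sum_congr rfl fun i _ => ?_
    rw [show j + 1 + i = j + (i + 1) by omega]

/-- Theorem 4.5: for a path with `n + 1` links (indexed `0, …, n`), each either
data-corrupting or packet-dropping, if the link indicators satisfy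
`l^{(j)} ∈ Λ_{ρ_j}` with `∑_j ρ_j ≤ 1`, then the end-to-end path failure
process `L^{(1)} = pathFrom l d n 0` satisfies `L^{(1)} ∈ Λ_{∑_j ρ_j}`. -/
theorem path_general {Ω : Type*} [MeasurableSpace Ω] (μ : Measure Ω)
    [IsProbabilityMeasure μ] (n : ℕ)
    (l : ℕ → ℕ → Ω → ℕ) (d : ℕ → LinkType)
    (hbin : ∀ j t ω, l j t ω ≤ 1) (hmeas : ∀ j t, Measurable (l j t))
    (ρ : ℕ → ℝ) (hρ : ∀ j, j ≤ n → ρ j ∈ Set.Icc (0 : ℝ) 1)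
    (hl : ∀ j, j ≤ n → MemLambda μ (l j) (ρ j))
    (hsum : ∑ j ∈ Finset.range (n + 1), ρ j ≤ 1) :
    MemLambda μ (pathFrom l d n 0) (∑ j ∈ Finset.range (n + 1), ρ j) := by
  unfold MemLambda at *
  have hle : ∀ k : ℕ, μ {ω | (∑ j ∈ Finset.range (n + 1), ρ j) * ((k : ℝ) + 1) <
      ∑ t ∈ Finset.range (k + 1), (pathFrom l d n 0 t ω : ℝ)} ≤
      ∑ j ∈ Finset.range (n + 1),
        μ {ω | ρ j * ((k : ℝ) + 1) < ∑ t ∈ Finset.range (k + 1), (l j t ω : ℝ)} := by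
    intro k
    refine (measure_mono ?_).trans (measure_biUnion_finset_le _ _)
    intro ω hω
    simp only [Set.mem_setOf_eq] at hω
    simp only [Set.mem_iUnion, Set.mem_setOf_eq]
    by_contra hcon
    push Not at hcon
    have h1 := Finset.sum_le_sum fun j hj => hcon j hj
    have h2 : ∑ t ∈ Finset.range (k + 1), (pathFrom l d n 0 t ω : ℝ) ≤
        ∑ j ∈ Finset.range (n + 1), ∑ t ∈ Finset.range (k + 1), (l j t ω : ℝ) := by
      have := pathFrom_sum_le l d hbin (k + 1) ω n 0
      simp only [zero_add] at this
      exact_mod_cast this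
    rw [Finset.sum_mul] at hω
    linarith
  refine (ENNReal.tsum_le_tsum hle).trans_lt ?_
  rw [Summable.tsum_finsetSum fun _ _ => ENNReal.summable]
  refine ENNReal.sum_lt_top.2 fun j hj => hl j ?_
  have := Finset.mem_range.1 hj
  omega
end
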